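/- Let q be a prime power, let k = F_q be the finite field with q elements, let d, n ≥ 1 with q > d + 1, and let A be any d×n matrix over k. Then there exists a vector X ∈ k^n such that every coordinate of X is nonzero and every coordinate of AX is nonzero, if and only if no row of A is identically zero. -/

import Mathlib

/-- If every affine form `b i + A i ⬝ X` is nonzero as a polynomial and `k` has more than
`card ι + 1` elements, then some `X` with nonzero coordinates is a zero of none of them. -/
theorem exists_ne_zero_forall_add_mulVec_ne_zero {k ι : Type*} [Field k] [Fintype k] [Fintype ι]
    (hq : Fintype.card ι + 1 < Fintype.card k) {n : ℕ} (A : Matrix ι (Fin n) k) (b : ι → k)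
    (h : ∀ i, b i ≠ 0 ∨ ∃ j, A i j ≠ 0) :
    ∃ X : Fin n → k, (∀ j, X j ≠ 0) ∧ ∀ i, b i + A.mulVec X i ≠ 0 := by
  classical
  induction n generalizing b with
  | zero =>
    refine ⟨Fin.elim0, fun j => j.elim0, fun i => ?_⟩
    simpa [Matrix.mulVec, dotProduct] using h i
  | succ n ih =>
    obtain ⟨x, -, hx⟩ := Finset.exists_mem_notMem_of_card_lt_card
      (s := insert 0 (Finset.univ.image fun i => -b i / A i 0)) (t := Finset.univ)
      ((Finset.card_insert_le _ _).trans_lt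
        ((Nat.add_le_add_right Finset.card_image_le 1).trans_lt hq))
    simp only [Finset.mem_insert, Finset.mem_image, Finset.mem_univ, true_and, not_or,
      not_exists] at hx
    obtain ⟨X, hX, hAX⟩ := ih (fun i j => A i j.succ) (fun i => b i + A i 0 * x) fun i => by
      by_cases hA : A i 0 = 0
      · simpa [Fin.exists_fin_succ, hA] using h i
      · refine Or.inl fun h0 => hx.2 i ?_
        rw [div_eq_iff hA]
        linear_combination -h0
    refine ⟨Fin.cons x X, Fin.cases hx.1 hX, fun i => ?_⟩
    simpa [Matrix.mulVec, dotProduct, Fin.sum_univ_succ, add_assoc] using hAX i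


/-- For a `d × n` matrix `A` over the finite field with `q > d + 1` elements, there is a
vector `X` such that both `X` and `A X` have all coordinates nonzero, if and only if no
row of `A` is identically zero. -/
theorem stmt19 (k : Type*) [Field k] [Fintype k] (d n : ℕ)
    (hd : 1 ≤ d) (hn : 1 ≤ n) (hq : d + 1 < Fintype.card k)
    (A : Matrix (Fin d) (Fin n) k) :
    (∃ X : Fin n → k, (∀ j, X j ≠ 0) ∧ ∀ i, A.mulVec X i ≠ 0) ↔
      ¬ ∃ i, ∀ j, A i j = 0 := by
  constructor
  · rintro ⟨X, -, hX⟩ ⟨i, hi⟩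
    exact hX i (by simp [Matrix.mulVec, dotProduct, hi])
  · intro h
    push Not at h
    simpa using exists_ne_zero_forall_add_mulVec_ne_zero (by simpa using hq) A 0
      fun i => Or.inr (h i)
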